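/- Let n ≥ 2, let E₁, …, Eₙ be alphabets, let E_s = ∪_{i≠j}(Eᵢ ∩ Eⱼ), and let E_k satisfy E_s ⊆ E_k ⊆ E := E₁ ∪ … ∪ Eₙ. For i = 1, …, n let (Kᵢ, Nᵢ) model a generator over Eᵢ and let (K_k, N_k) model a generator over E_k, and set K = K₁ ∥ … ∥ Kₙ ∥ K_k and N = N₁ ∥ … ∥ Nₙ ∥ N_k. Then the chain of inclusions overline(K) ⊆ P_{1+k}(overline(K)) ∥ … ∥ P_{n+k}(overline(K)) ⊆ P_{1+k}(N) ∥ … ∥ P_{n+k}(N) = N always holds. Consequently, if the coordinated system is nonblocking (overline(K) = N), then overline(K) is conditionally decomposable with respect to E₁, …, Eₙ and E_k; i.e., conditional decomposability is a weaker condition than nonblockingness. -/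

import Mathlib

/- Language-theoretic model of discrete-event systems:
   strings over a finite alphabet (a `Finset` of symbols) are lists,
   natural projections erase letters outside the target alphabet,
   and the parallel composition is the standard synchronous composition. -/

namespace DES

variable {A : Type} [DecidableEq A]

/-- `star E` is `E*`: the set of finite strings over the alphabet `E`. -/
def star (E : Finset A) : Set (List A) :=
  {w | ∀ a ∈ w, a ∈ E}

/-- The natural projection onto `E₀`: it keeps letters of `E₀` and erases all
other letters. -/
def proj (E₀ : Finset A) (w : List A) : List A :=
  w.filter (· ∈ E₀)

/-- The inverse image `P⁻¹(L) = { s ∈ E* : P(s) ∈ L }` of the natural projection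
from `E*` onto `E₀*`. -/
def invProj (E E₀ : Finset A) (L : Set (List A)) : Set (List A) :=
  {s | s ∈ star E ∧ proj E₀ s ∈ L}

/-- Parallel composition `L₁ ∥ L₂ = P₁⁻¹(L₁) ∩ P₂⁻¹(L₂) ⊆ (E₁ ∪ E₂)*` of
`L₁ ⊆ E₁*` and `L₂ ⊆ E₂*`. -/
def par (E₁ E₂ : Finset A) (L₁ L₂ : Set (List A)) : Set (List A) :=
  invProj (E₁ ∪ E₂) E₁ L₁ ∩ invProj (E₁ ∪ E₂) E₂ L₂

/-- Parallel composition of a finite family `L i ⊆ (E i)*`. -/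
def parFam {ι : Type} [Fintype ι] (E : ι → Finset A) (L : ι → Set (List A)) :
    Set (List A) :=
  {w | w ∈ star (Finset.univ.sup E) ∧ ∀ i, proj (E i) w ∈ L i}

/-- The prefix closure of a language. -/
def pref (L : Set (List A)) : Set (List A) :=
  {w | ∃ u, w ++ u ∈ L}

/-- `K` is conditionally decomposable w.r.t. the alphabets `E i` and `Ek`:
`K = P_{1+k}(K) ∥ ⋯ ∥ P_{n+k}(K)`. -/
def condDecomp {ι : Type} [Fintype ι] (E : ι → Finset A) (Ek : Finset A)
    (K : Set (List A)) : Prop :=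
  K = parFam (fun i => E i ∪ Ek) (fun i => proj (E i ∪ Ek) '' K)

/-- Conditional decomposability for two components:
`K = P_{1+k}(K) ∥ P_{2+k}(K)`. -/
def condDecomp2 (E₁ E₂ Ek : Finset A) (K : Set (List A)) : Prop :=
  K = par (E₁ ∪ Ek) (E₂ ∪ Ek) (proj (E₁ ∪ Ek) '' K) (proj (E₂ ∪ Ek) '' K)

/-- The natural projection from `E'*` onto `E₀*` is an `L`-observer. -/
def observer (E' E₀ : Finset A) (L : Set (List A)) : Prop :=
  ∀ t ∈ proj E₀ '' L, ∀ s ∈ pref L, proj E₀ s <+: t →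
    ∃ u ∈ star E', s ++ u ∈ L ∧ proj E₀ (s ++ u) = t

/-- Letter-to-letter renaming map: letters in `Ekeep` are kept, all other
letters are renamed by `g`. -/
def ren (Ekeep : Finset A) (g : A → A) (w : List A) : List A :=
  w.map (fun a => if a ∈ Ekeep then a else g a)


theorem proj_proj_of_subset {A : Type} [DecidableEq A] {E F : Finset A} (h : E ⊆ F)
    (w : List A) : proj E (proj F w) = proj E w := by
  simp only [proj, List.filter_filter]
  refine List.filter_congr fun a _ => ?_
  by_cases ha : a ∈ E
  · simp [ha, h ha]
  · simp [ha]

theorem proj_append {A : Type} [DecidableEq A] (E : Finset A) (v w : List A) :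
    proj E (v ++ w) = proj E v ++ proj E w :=
  List.filter_append v w

theorem proj_mem_star {A : Type} [DecidableEq A] (E : Finset A) (w : List A) :
    proj E w ∈ star E := by
  intro a ha
  simpa using (List.mem_filter.1 ha).2

theorem mem_par_parFam {A ι : Type} [DecidableEq A] [Fintype ι] {E : ι → Finset A}
    {F : Finset A} {L : ι → Set (List A)} {M : Set (List A)} {w : List A} :
    w ∈ par (Finset.univ.sup E) F (parFam E L) M ↔
      w ∈ star (Finset.univ.sup E ∪ F) ∧ (∀ i, proj (E i) w ∈ L i) ∧ proj F w ∈ M := by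
  have hproj (i : ι) : proj (E i) (proj (Finset.univ.sup E) w) = proj (E i) w :=
    proj_proj_of_subset (Finset.le_sup (Finset.mem_univ i)) w
  constructor
  · rintro ⟨⟨hw, -, hL⟩, -, hM⟩
    exact ⟨hw, fun i => hproj i ▸ hL i, hM⟩
  · rintro ⟨hw, hL, hM⟩
    exact ⟨⟨hw, proj_mem_star _ w, fun i => (hproj i).symm ▸ hL i⟩, hw, hM⟩

theorem pref_par_parFam_subset {A ι : Type} [DecidableEq A] [Fintype ι]
    {E : ι → Finset A} {F : Finset A} {K N : ι → Set (List A)} {Kk Nk : Set (List A)}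
    (hKN : ∀ i, pref (K i) ⊆ N i) (hKNk : pref Kk ⊆ Nk) :
    pref (par (Finset.univ.sup E) F (parFam E K) Kk) ⊆
      par (Finset.univ.sup E) F (parFam E N) Nk := by
  rintro w ⟨u, hu⟩
  obtain ⟨hstar, hK, hKk⟩ := mem_par_parFam.1 hu
  refine mem_par_parFam.2 ⟨fun a ha => hstar a (List.mem_append_left u ha), fun i => ?_, ?_⟩
  · exact hKN i ⟨proj (E i) u, proj_append (E i) w u ▸ hK i⟩
  · exact hKNk ⟨proj F u, proj_append F w u ▸ hKk⟩

theorem sup_union_const {A ι : Type} [DecidableEq A] [Fintype ι] [Nonempty ι]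
    (E : ι → Finset A) (F : Finset A) :
    Finset.univ.sup (fun i => E i ∪ F) = Finset.univ.sup E ∪ F := by
  have h := Finset.sup_sup (s := Finset.univ) (f := E) (g := fun _ => F)
  rw [Finset.sup_const Finset.univ_nonempty] at h
  exact h

theorem subset_parFam_image {A ι : Type} [DecidableEq A] [Fintype ι] {E : ι → Finset A}
    {L : Set (List A)} (hL : L ⊆ star (Finset.univ.sup E)) :
    L ⊆ parFam E (fun i => proj (E i) '' L) :=
  fun w hw => ⟨hL hw, fun _ => ⟨w, hw, rfl⟩⟩

theorem parFam_mono {A ι : Type} [DecidableEq A] [Fintype ι] {E : ι → Finset A}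
    {L M : ι → Set (List A)} (h : ∀ i, L i ⊆ M i) : parFam E L ⊆ parFam E M :=
  fun _ hw => ⟨hw.1, fun i => h i (hw.2 i)⟩

theorem par_parFam_subset_star {A ι : Type} [DecidableEq A] [Fintype ι] [Nonempty ι]
    {E : ι → Finset A} {F : Finset A} {L : ι → Set (List A)} {M : Set (List A)} :
    par (Finset.univ.sup E) F (parFam E L) M ⊆
      star (Finset.univ.sup fun i => E i ∪ F) := by
  rw [sup_union_const]
  exact fun _ hw => hw.1.1

/-- A composition with a coordinator over `F` is recovered from its projections to the
alphabets `E i ∪ F`. -/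
theorem condDecomp_par_parFam {A ι : Type} [DecidableEq A] [Fintype ι] [Nonempty ι]
    (E : ι → Finset A) (F : Finset A) (L : ι → Set (List A)) (M : Set (List A)) :
    condDecomp E F (par (Finset.univ.sup E) F (parFam E L) M) := by
  refine (subset_parFam_image par_parFam_subset_star).antisymm ?_
  rintro w ⟨hstar, hw⟩
  rw [sup_union_const] at hstar
  refine mem_par_parFam.2 ⟨hstar, fun i => ?_, ?_⟩
  · obtain ⟨v, hv, hvw⟩ := hw i
    have h : E i ⊆ E i ∪ F := Finset.subset_union_left
    rw [← proj_proj_of_subset h, ← hvw, proj_proj_of_subset h]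
    exact (mem_par_parFam.1 hv).2.1 i
  · obtain ⟨i⟩ := ‹Nonempty ι›
    obtain ⟨v, hv, hvw⟩ := hw i
    have h : F ⊆ E i ∪ F := Finset.subset_union_right
    rw [← proj_proj_of_subset h, ← hvw, proj_proj_of_subset h]
    exact (mem_par_parFam.1 hv).2.2

/-- the chain
`overline(K) ⊆ ∥ᵢ P_{i+k}(overline(K)) ⊆ ∥ᵢ P_{i+k}(N) = N` always holds;
consequently, nonblockingness of the coordinated system implies conditional
decomposability of `overline(K)`. -/
theorem stmt12 {A : Type} [DecidableEq A] {n : ℕ} (hn : 2 ≤ n)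
    (E : Fin n → Finset A) (Ek : Finset A)
    (hs : ∀ i j, i ≠ j → E i ∩ E j ⊆ Ek)
    (hkE : Ek ⊆ Finset.univ.sup E)
    (K N : Fin n → Set (List A)) (Kk Nk : Set (List A))
    (hKE : ∀ i, K i ⊆ star (E i)) (hNE : ∀ i, N i ⊆ star (E i))
    (hNpc : ∀ i, pref (N i) = N i) (hKN : ∀ i, pref (K i) ⊆ N i)
    (hKkE : Kk ⊆ star Ek) (hNkE : Nk ⊆ star Ek)
    (hNkpc : pref Nk = Nk) (hKNk : pref Kk ⊆ Nk)
    (GK GN : Set (List A))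
    (hGK : GK = par (Finset.univ.sup E) Ek (parFam E K) Kk)
    (hGN : GN = par (Finset.univ.sup E) Ek (parFam E N) Nk) :
    pref GK ⊆
      parFam (fun i => E i ∪ Ek) (fun i => proj (E i ∪ Ek) '' pref GK) ∧
    parFam (fun i => E i ∪ Ek) (fun i => proj (E i ∪ Ek) '' pref GK) ⊆
      parFam (fun i => E i ∪ Ek) (fun i => proj (E i ∪ Ek) '' GN) ∧
    parFam (fun i => E i ∪ Ek) (fun i => proj (E i ∪ Ek) '' GN) = GN ∧
    (pref GK = GN → condDecomp E Ek (pref GK)) := by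
  have : Nonempty (Fin n) := ⟨⟨0, by omega⟩⟩
  have hsub : pref GK ⊆ GN := by
    rw [hGK, hGN]
    exact pref_par_parFam_subset hKN hKNk
  have hdec : condDecomp E Ek GN := hGN ▸ condDecomp_par_parFam E Ek N Nk
  refine ⟨subset_parFam_image (hsub.trans ?_),
    parFam_mono fun i => Set.image_mono hsub, hdec.symm, fun h => h ▸ hdec⟩
  rw [hGN]
  exact par_parFam_subset_star

end DES
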